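/- Let t be a node of the rooted tree decomposition (T, {X_t}) of D_{M,b} with a unique child t' such that X_t = X_{t'} ∪ {i} for some i ∉ V_{t'}. Then for every b-monotone f : X_t → [n], T_t[f] = T_{t'}[f|_{X_{t'}}] + w(e_{f(i)}) − Σ_{{u,v} ∈ ΔE⁺_f} w({u,v}), where ΔE⁺_f denotes the multiset of added edges determined by pairs of M with one index equal to i and the other index in X_t (i.e., the added-edge terms of f not already counted for f|_{X_{t'}}), and where the maxima defining T_t and T_{t'} are taken in ℤ ∪ {−∞} (value −∞ for an empty set of extensions). -/

import Mathlib

/-- The `i`-th edge of the reference tour `H` on `Fin n`: `{w_i, w_{i+1}}` (cyclically). -/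
def tourEdge (n : ℕ) (i : Fin n) : Sym2 (Fin n) :=
  s(i, ⟨(i.val + 1) % n, Nat.mod_lt _ (by have := i.isLt; omega)⟩)

/-- The endpoints `v_1, …, v_{2k}` (0-indexed: `v_{2j}` is the left endpoint of
`e_{f(j)}` and `v_{2j+1}` its right endpoint). -/
def endpointMap (n k : ℕ) (f : Fin k → Fin n) : Fin (2 * k) → Fin n :=
  fun p =>
    if p.val % 2 = 0 then f ⟨p.val / 2, by have := p.isLt; omega⟩
    else ⟨((f ⟨p.val / 2, by have := p.isLt; omega⟩).val + 1) % n,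
          Nat.mod_lt _ (by have := (f ⟨p.val / 2, by have := p.isLt; omega⟩).isLt; omega)⟩

/-- The index `⌈i'/2⌉ ∈ [k]` of a matching vertex `i' ∈ [2k]` (0-indexed: `v ↦ ⌊v/2⌋`). -/
def halfIdx (k : ℕ) (v : Fin (2 * k)) : Fin k :=
  ⟨v.val / 2, by have := v.isLt; omega⟩

/-- A perfect matching on the vertex set `V`, given by its edge set. -/
def IsPerfectMatchingEdgeSet {V : Type*} (M : Set (Sym2 V)) : Prop :=
  (∀ e ∈ M, ¬ e.IsDiag) ∧ ∀ v : V, ∃! e, e ∈ M ∧ v ∈ e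

/-- The identification pairs for validity: (1-indexed) `2i ~ (2i+1) mod 2k`. -/
def nuEdges (k : ℕ) : Set (Sym2 (Fin (2 * k))) :=
  { e | ∃ j : Fin k,
      e = s((⟨(2 * j.val + 1) % (2 * k), Nat.mod_lt _ (by have := j.isLt; omega)⟩ : Fin (2 * k)),
            (⟨(2 * j.val + 2) % (2 * k), Nat.mod_lt _ (by have := j.isLt; omega)⟩ : Fin (2 * k))) }

/-- A valid connection `k`-pattern. -/
def IsValidPattern (k : ℕ) (M : Set (Sym2 (Fin (2 * k)))) : Prop :=
  IsPerfectMatchingEdgeSet M ∧ (SimpleGraph.fromEdgeSet (M ∪ nuEdges k)).Connected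

/-- `I_M`: the edge set on `[k]` obtained from `M` by identifying `2i-1, 2i ↦ i`. -/
def IM (k : ℕ) (M : Set (Sym2 (Fin (2 * k)))) : Set (Sym2 (Fin k)) :=
  { e | ¬ e.IsDiag ∧ ∃ e' ∈ M, Sym2.map (halfIdx k) e' = e }

/-- `O_b = {{i, i+1} : b i = b (i+1)}`, the order dependencies. -/
def Ob (k nb : ℕ) (b : Fin k → Fin nb) : Set (Sym2 (Fin k)) :=
  { e | ∃ (i : ℕ) (h : i + 1 < k),
      b ⟨i, by omega⟩ = b ⟨i + 1, h⟩ ∧ e = s((⟨i, by omega⟩ : Fin k), (⟨i + 1, h⟩ : Fin k)) }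

/-- `f` is a `b`-monotone partial embedding with domain `S` (values outside `S`
are irrelevant): (M1) `bo (f i) = b i` on `S`; (M2) `f i < f (i+1)` whenever
`{i, i+1} ∈ O_b` and `i, i+1 ∈ S`. -/
def BMonotoneOn (n k nb : ℕ) (bo : Fin n → Fin nb) (b : Fin k → Fin nb)
    (S : Set (Fin k)) (f : Fin k → Fin n) : Prop :=
  (∀ i ∈ S, bo (f i) = b i) ∧
  (∀ (i : ℕ) (h : i + 1 < k), (⟨i, by omega⟩ : Fin k) ∈ S → (⟨i + 1, h⟩ : Fin k) ∈ S →
    b ⟨i, by omega⟩ = b ⟨i + 1, h⟩ → f ⟨i, by omega⟩ < f ⟨i + 1, h⟩)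

/-- The `M`-gain of the partial embedding `f` with domain `S`: the total weight of
the removed edges `e_{f j}`, `j ∈ S`, minus the total weight of the added edges,
i.e. of the edges `{v_{i'}, v_{j'}}` over all pairs `{i', j'} ∈ M` both of whose
endpoint indices lie (after halving) in `S` (summed with multiplicity over the
pairs of `M`). -/
noncomputable def gainM (n k : ℕ) (w : Sym2 (Fin n) → ℤ) (M : Set (Sym2 (Fin (2 * k))))
    (S : Set (Fin k)) (f : Fin k → Fin n) : ℤ :=
  (∑ᶠ j ∈ S, w (tourEdge n (f j))) -
    ∑ᶠ e ∈ { e' : Sym2 (Fin (2 * k)) | e' ∈ M ∧ ∀ v ∈ e', halfIdx k v ∈ S },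
      w (Sym2.map (endpointMap n k f) e)

/-- `(T, X)` is a tree decomposition of the graph `G`. -/
def TreeDecompOf {V ι : Type} (G : SimpleGraph V) (T : SimpleGraph ι)
    (X : ι → Finset V) : Prop :=
  T.IsTree ∧ (∀ v, ∃ t, v ∈ X t) ∧
    (∀ e ∈ G.edgeSet, ∃ t, ∀ v ∈ e, v ∈ X t) ∧
    (∀ v : V, (T.induce { t | v ∈ X t }).Connected)

/-- The set of nodes in the subtree rooted at `t` of the tree `T` rooted at `r`:
those nodes all of whose walks to the root pass through `t`. -/
def descend {ι : Type} (T : SimpleGraph ι) (r t : ι) : Set ι :=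
  { s | ∀ p : T.Walk s r, t ∈ p.support }

/-- `V_t`: the union of the bags in the subtree rooted at `t`. -/
def Vt {V ι : Type} (T : SimpleGraph ι) (X : ι → Finset V) (r t : ι) : Set V :=
  { v | ∃ s ∈ descend T r t, v ∈ X s }

/-- The dynamic-programming table: `T_t[f]` is the maximum (in `ℤ ∪ {−∞}`,
realized as `EReal`, with `sSup ∅ = ⊥`) of `gain_M(g)` over all `b`-monotone
`g : V_t → [n]` with `g|_{X_t} = f`. -/
noncomputable def Ttab (n k nb : ℕ) (w : Sym2 (Fin n) → ℤ) (M : Set (Sym2 (Fin (2 * k))))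
    (bo : Fin n → Fin nb) (b : Fin k → Fin nb) {ι : Type} (T : SimpleGraph ι)
    (X : ι → Finset (Fin k)) (r t : ι) (f : Fin k → Fin n) : EReal :=
  sSup { x : EReal | ∃ g : Fin k → Fin n,
    BMonotoneOn n k nb bo b (Vt T X r t) g ∧ (∀ j ∈ X t, g j = f j) ∧
    x = ((gainM n k w M (Vt T X r t) g : ℝ) : EReal) }

theorem mem_descend_of_adj {ι : Type} {T : SimpleGraph ι} {r t t' : ι}
    (hdesc : t' ∈ descend T r t) {s : ι} (hs : s ∈ descend T r t') : s ∈ descend T r t := by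
  classical
  intro p
  exact SimpleGraph.Walk.support_dropUntil_subset_support p (hs p) (hdesc (p.dropUntil t' (hs p)))

theorem descend_of_unique_child {ι : Type} {T : SimpleGraph ι} {r t t' : ι}
    (huniq : ∀ s, T.Adj t s → s ∈ descend T r t → s = t')
    {s : ι} (hs : s ∈ descend T r t) (hst : s ≠ t) : s ∈ descend T r t' := by
  suffices key : ∀ (a c : ι) (p : T.Walk a c), c = r → a ∈ descend T r t → a ≠ t →
      t' ∈ p.support from fun p => key s r p rfl hs hst
  intro a c p
  induction p with
  | nil =>
    intro hc ha hat
    subst hc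
    have := ha SimpleGraph.Walk.nil
    simp at this
    exact absurd this.symm hat
  | @cons a x c hax p ih =>
    intro hc ha hat
    subst hc
    rw [SimpleGraph.Walk.support_cons]
    by_cases hx : x = t
    · subst hx
      rw [huniq a hax.symm ha]
      exact List.mem_cons_self
    · refine List.mem_cons_of_mem _ (ih rfl (fun q => ?_) hx)
      have h := ha (SimpleGraph.Walk.cons hax q)
      rw [SimpleGraph.Walk.support_cons, List.mem_cons] at h
      exact h.resolve_left (fun h => hat h.symm)

theorem Vt_eq_insert {V ι : Type} [DecidableEq V] {T : SimpleGraph ι} {X : ι → Finset V}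
    {r t t' : ι} (hdesc : t' ∈ descend T r t)
    (huniq : ∀ s, T.Adj t s → s ∈ descend T r t → s = t')
    {i : V} (hX : X t = insert i (X t')) : Vt T X r t = insert i (Vt T X r t') := by
  have ht : t ∈ descend T r t := fun p => p.start_mem_support
  have ht' : t' ∈ descend T r t' := fun p => p.start_mem_support
  ext v
  constructor
  · rintro ⟨s, hs, hv⟩
    by_cases hst : s = t
    · subst hst
      rw [hX, Finset.mem_insert] at hv
      exact hv.imp id fun hv => ⟨t', ht', hv⟩
    · exact Or.inr ⟨s, descend_of_unique_child huniq hs hst, hv⟩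
  · rintro (rfl | ⟨s, hs, hv⟩)
    · exact ⟨t, ht, by simp [hX]⟩
    · exact ⟨s, mem_descend_of_adj hdesc hs, hv⟩

/-- A vertex of `V_t` adjacent to a vertex outside `V_t` lies in the bag `X_t`. -/
theorem mem_bag_of_adj_of_notMem_Vt {V ι : Type} {G : SimpleGraph V} {T : SimpleGraph ι}
    {X : ι → Finset V} (hTD : TreeDecompOf G T X) {r t : ι} {i j : V} (hij : G.Adj i j)
    (hi : i ∉ Vt T X r t) (hj : j ∈ Vt T X r t) : j ∈ X t := by
  obtain ⟨-, -, hedge, hconn⟩ := hTD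
  obtain ⟨s, hs⟩ := hedge s(i, j) hij
  have his : i ∈ X s := hs i (by simp)
  have hjs : j ∈ X s := hs j (by simp)
  obtain ⟨s', hs', hjs'⟩ := hj
  have hsd : s ∉ descend T r t := fun h => hi ⟨s, h, his⟩
  simp only [descend, Set.mem_ofPred_eq, not_forall] at hsd
  obtain ⟨p, hp⟩ := hsd
  obtain ⟨q⟩ := (hconn j).preconnected ⟨s', hjs'⟩ ⟨s, hjs⟩
  have h := hs' ((q.map (SimpleGraph.Embedding.induce _).toHom).append p)
  have h := ((SimpleGraph.Walk.mem_support_append_iff _ _).1 h).resolve_right hp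
  obtain ⟨⟨x, hx⟩, -, rfl⟩ :=
    List.mem_map.1 ((congrArg (t ∈ ·) (SimpleGraph.Walk.support_map _ q)).mp h)
  exact hx

theorem sym2_map_endpointMap_congr {n k : ℕ} {S : Set (Fin k)} {f g : Fin k → Fin n}
    (hfg : ∀ j ∈ S, f j = g j) {e : Sym2 (Fin (2 * k))} (he : ∀ v ∈ e, halfIdx k v ∈ S) :
    Sym2.map (endpointMap n k f) e = Sym2.map (endpointMap n k g) e := by
  refine Sym2.map_congr fun v hv => ?_
  have := hfg _ (he v hv)
  simp only [halfIdx] at this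
  simp only [endpointMap, this]

theorem gainM_congr {n k : ℕ} (w : Sym2 (Fin n) → ℤ) (M : Set (Sym2 (Fin (2 * k))))
    {S : Set (Fin k)} {f g : Fin k → Fin n} (hfg : ∀ j ∈ S, f j = g j) :
    gainM n k w M S f = gainM n k w M S g := by
  unfold gainM
  congr 1
  · exact finsum_mem_congr rfl fun j hj => by rw [hfg j hj]
  · exact finsum_mem_congr rfl fun e he => by rw [sym2_map_endpointMap_congr hfg he.2]

theorem gainM_insert {n k : ℕ} (w : Sym2 (Fin n) → ℤ) (M : Set (Sym2 (Fin (2 * k))))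
    {S : Set (Fin k)} {i : Fin k} (hi : i ∉ S) (g : Fin k → Fin n) :
    gainM n k w M (insert i S) g = gainM n k w M S g +
      (w (tourEdge n (g i)) -
        ∑ᶠ e ∈ { e' : Sym2 (Fin (2 * k)) | e' ∈ M ∧
            ∃ u v : Fin (2 * k), e' = s(u, v) ∧ halfIdx k u = i ∧ halfIdx k v ∈ insert i S },
          w (Sym2.map (endpointMap n k g) e)) := by
  have hset : { e' : Sym2 (Fin (2 * k)) | e' ∈ M ∧ ∀ v ∈ e', halfIdx k v ∈ insert i S } =
      { e' : Sym2 (Fin (2 * k)) | e' ∈ M ∧ ∀ v ∈ e', halfIdx k v ∈ S } ∪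
      { e' : Sym2 (Fin (2 * k)) | e' ∈ M ∧
        ∃ u v : Fin (2 * k), e' = s(u, v) ∧ halfIdx k u = i ∧ halfIdx k v ∈ insert i S } := by
    ext e
    constructor
    · rintro ⟨heM, he⟩
      by_cases h : ∀ v ∈ e, halfIdx k v ∈ S
      · exact Or.inl ⟨heM, h⟩
      · push Not at h
        obtain ⟨u, hu, huS⟩ := h
        obtain ⟨v, rfl⟩ := hu
        exact Or.inr ⟨heM, u, v, rfl, (he u (by simp)).resolve_right huS, he v (by simp)⟩
    · rintro (⟨heM, he⟩ | ⟨heM, u, v, rfl, hu, hv⟩)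
      · exact ⟨heM, fun v hv => Or.inr (he v hv)⟩
      · refine ⟨heM, fun x hx => ?_⟩
        rcases Sym2.mem_iff.1 hx with rfl | rfl
        · exact Or.inl hu
        · exact hv
  have hdisj : Disjoint { e' : Sym2 (Fin (2 * k)) | e' ∈ M ∧ ∀ v ∈ e', halfIdx k v ∈ S }
      { e' : Sym2 (Fin (2 * k)) | e' ∈ M ∧
        ∃ u v : Fin (2 * k), e' = s(u, v) ∧ halfIdx k u = i ∧ halfIdx k v ∈ insert i S } := by
    rw [Set.disjoint_left]
    rintro e ⟨-, he⟩ ⟨-, u, v, rfl, hu, -⟩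
    exact hi (hu ▸ he u (by simp))
  unfold gainM
  rw [hset, finsum_mem_union hdisj (Set.toFinite _) (Set.toFinite _),
    finsum_mem_insert _ hi (Set.toFinite _)]
  ring

theorem BMonotoneOn.mono {n k nb : ℕ} {bo : Fin n → Fin nb} {b : Fin k → Fin nb}
    {S S' : Set (Fin k)} {f : Fin k → Fin n} (hf : BMonotoneOn n k nb bo b S f)
    (h : S' ⊆ S) : BMonotoneOn n k nb bo b S' f :=
  ⟨fun i hi => hf.1 i (h hi), fun i hi h₁ h₂ => hf.2 i hi (h h₁) (h h₂)⟩

/-- Monotone embeddings on `S` and on `A` glue to one on `S ∪ {i}` when all order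
dependencies of `i` within `S` lie in `A`. -/
theorem BMonotoneOn.insert {n k nb : ℕ} {bo : Fin n → Fin nb} {b : Fin k → Fin nb}
    {S A : Set (Fin k)} {i : Fin k} {f g : Fin k → Fin n}
    (hf : BMonotoneOn n k nb bo b A f) (hiA : i ∈ A) (hg : BMonotoneOn n k nb bo b S g)
    (hgf : ∀ j ∈ insert i S, j ∈ A → g j = f j)
    (hA : ∀ j ∈ S, s(i, j) ∈ Ob k nb b → j ∈ A) :
    BMonotoneOn n k nb bo b (insert i S) g := by
  have hgi : g i = f i := hgf i (Or.inl rfl) hiA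
  refine ⟨?_, ?_⟩
  · rintro j (rfl | hj)
    · rw [hgi]
      exact hf.1 j hiA
    · exact hg.1 j hj
  · intro j hj h₁ h₂ hb
    have hOb : s((⟨j, by omega⟩ : Fin k), (⟨j + 1, hj⟩ : Fin k)) ∈ Ob k nb b := ⟨j, hj, hb, rfl⟩
    have hboth : (⟨j, by omega⟩ : Fin k) ∈ A → (⟨j + 1, hj⟩ : Fin k) ∈ A →
        g ⟨j, by omega⟩ < g ⟨j + 1, hj⟩ := fun a₁ a₂ => by
      rw [hgf _ h₁ a₁, hgf _ h₂ a₂]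
      exact hf.2 j hj a₁ a₂ hb
    rcases h₁ with e₁ | m₁
    · rcases h₂ with e₂ | m₂
      · exact hboth (e₁ ▸ hiA) (e₂ ▸ hiA)
      · exact hboth (e₁ ▸ hiA) (hA _ m₂ (e₁ ▸ hOb))
    · rcases h₂ with e₂ | m₂
      · exact hboth (hA _ m₁ (by rw [Sym2.eq_swap, ← e₂]; exact hOb)) (e₂ ▸ hiA)
      · exact hg.2 j hj m₁ m₂ hb

theorem EReal.sSup_image_add_coe (A : Set EReal) (c : ℝ) :
    sSup ((fun x => x + (c : EReal)) '' A) = sSup A + c := by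
  have hc : ∀ {x y : EReal}, x + c ≤ y ↔ x ≤ y - c := fun {x y} =>
    (EReal.le_sub_iff_add_le (Or.inl (EReal.coe_ne_bot c)) (Or.inl (EReal.coe_ne_top c))).symm
  apply le_antisymm
  · refine sSup_le ?_
    rintro _ ⟨x, hx, rfl⟩
    exact add_le_add_left (le_sSup hx) _
  · rw [hc]
    exact sSup_le fun x hx => hc.1 (le_sSup ⟨x, hx, rfl⟩)

/-- introduce node.  Let `t` be a node of the rooted tree
decomposition of `D_{M,b}` with unique child `t'`, with `X_t = X_{t'} ∪ {i}` for
some `i ∉ V_{t'}`.  Then for every `b`-monotone `f : X_t → [n]`,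
`T_t[f] = T_{t'}[f|_{X_{t'}}] + w(e_{f i}) − Σ_{ΔE⁺_f} w`, where `ΔE⁺_f` is given
by the pairs of `M` with one index (after halving) equal to `i` and the other in `X_t`. -/
theorem stmt_8 (n k nb : ℕ) (hn : 0 < n) (hk : 2 ≤ k)
    (w : Sym2 (Fin n) → ℤ)
    (M : Set (Sym2 (Fin (2 * k)))) (hM : IsValidPattern k M)
    (bo : Fin n → Fin nb) (hbo : Monotone bo) (hbos : Function.Surjective bo)
    (b : Fin k → Fin nb) (hb : Monotone b)
    (ι : Type) (T : SimpleGraph ι) (X : ι → Finset (Fin k))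
    (hTD : TreeDecompOf (SimpleGraph.fromEdgeSet (IM k M ∪ Ob k nb b)) T X)
    (r t t' : ι)
    (hadj : T.Adj t t') (hdesc : t' ∈ descend T r t)
    (huniq : ∀ s, T.Adj t s → s ∈ descend T r t → s = t')
    (i : Fin k) (hX : X t = insert i (X t')) (hiV : i ∉ Vt T X r t')
    (f : Fin k → Fin n) (hf : BMonotoneOn n k nb bo b (↑(X t)) f) :
    Ttab n k nb w M bo b T X r t f =
      Ttab n k nb w M bo b T X r t' f +
        (((w (tourEdge n (f i)) -
            ∑ᶠ e ∈ { e' : Sym2 (Fin (2 * k)) | e' ∈ M ∧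
                ∃ u v : Fin (2 * k), e' = s(u, v) ∧ halfIdx k u = i ∧ halfIdx k v ∈ X t },
              w (Sym2.map (endpointMap n k f) e) : ℤ) : ℝ) : EReal) := by
  classical
  have hV := Vt_eq_insert hdesc huniq hX
  have hsub : ∀ j ∈ X t', j ∈ X t := fun j hj => by simp [hX, hj]
  have hiX : i ∈ X t := by simp [hX]
  have hXV : ∀ j ∈ X t', j ∈ Vt T X r t' := fun j hj => ⟨t', fun p => p.start_mem_support, hj⟩
  have hnbr : ∀ j ∈ Vt T X r t', s(i, j) ∈ IM k M ∪ Ob k nb b → j ∈ X t' := by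
    intro j hj he
    refine mem_bag_of_adj_of_notMem_Vt hTD (i := i) ?_ hiV hj
    rw [SimpleGraph.fromEdgeSet_adj]
    exact ⟨he, fun h => hiV (h ▸ hj)⟩
  have hgain : ∀ g : Fin k → Fin n, (∀ j ∈ X t, g j = f j) →
      gainM n k w M (Vt T X r t) g = gainM n k w M (Vt T X r t') g +
        (w (tourEdge n (f i)) -
          ∑ᶠ e ∈ { e' : Sym2 (Fin (2 * k)) | e' ∈ M ∧
              ∃ u v : Fin (2 * k), e' = s(u, v) ∧ halfIdx k u = i ∧ halfIdx k v ∈ X t },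
            w (Sym2.map (endpointMap n k f) e)) := by
    intro g hg
    rw [hV, gainM_insert w M hiV, hg i hiX]
    congr 2
    refine finsum_mem_congr ?_ ?_
    · ext e
      refine and_congr_right fun heM => exists_congr fun u => exists_congr fun v =>
        and_congr_right fun he => and_congr_right fun hu => ?_
      rw [hX, Finset.mem_insert, Set.mem_insert_iff]
      refine or_congr_right' fun hv => ⟨fun hvV => hnbr _ hvV (Or.inl ⟨?_, e, heM, ?_⟩), hXV _⟩
      · rw [Sym2.mk_isDiag_iff]
        exact fun h => hv h.symm
      · rw [he, Sym2.map_mk, hu]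
    · rintro e ⟨-, u, v, rfl, hu, hv⟩
      rw [sym2_map_endpointMap_congr (S := ↑(X t)) hg]
      intro x hx
      rcases Sym2.mem_iff.1 hx with rfl | rfl
      · rw [hu]
        exact hiX
      · exact hv
  unfold Ttab
  rw [← EReal.sSup_image_add_coe]
  congr 1
  ext x
  constructor
  · rintro ⟨g, hgm, hgf, rfl⟩
    refine ⟨_, ⟨g, hgm.mono (hV ▸ Set.subset_insert _ _), fun j hj => hgf j (hsub j hj), rfl⟩, ?_⟩
    rw [hgain g hgf]
    push_cast
    rfl
  · rintro ⟨_, ⟨g, hgm, hgf, rfl⟩, rfl⟩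
    have hne : ∀ j ∈ Vt T X r t', Function.update g i (f i) j = g j := fun j hj =>
      Function.update_of_ne (by rintro rfl; exact hiV hj) _ _
    have hgf' : ∀ j ∈ X t, Function.update g i (f i) j = f j := by
      intro j hj
      rw [hX, Finset.mem_insert] at hj
      rcases hj with rfl | hj
      · exact Function.update_self ..
      · rw [hne j (hXV j hj), hgf j hj]
    have hgm' : BMonotoneOn n k nb bo b (Vt T X r t') (Function.update g i (f i)) := by
      refine ⟨fun j hj => ?_, fun j hj h₁ h₂ hb => ?_⟩
      · rw [hne j hj]
        exact hgm.1 j hj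
      · rw [hne _ h₁, hne _ h₂]
        exact hgm.2 j hj h₁ h₂ hb
    refine ⟨Function.update g i (f i), ?_, hgf', ?_⟩
    · rw [hV]
      exact hf.insert hiX hgm' (fun j _ hj => hgf' j hj)
        fun j hj he => hsub j (hnbr j hj (Or.inr he))
    · rw [hgain _ hgf', gainM_congr w M hne]
      push_cast
      rfl
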